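/- Let d ≥ 2, β > 0, 0 < δ < 1, and let Ψ be a translation invariant, spin-flip symmetric interaction on Ω = {1,-1}^{Z^d} which is zero on non-‖·‖_1-connected sets and satisfies ‖Ψ‖ < δ; write Φ = Φ^β + Ψ. Let Λ ⋐ Z^d be c-connected and let γ_1, …, γ_n be contours such that int γ_1, …, int γ_n ⊆ Λ and these interiors are pairwise disjoint. Then μ^+_{Φ,Λ}({ω ∈ Ω_Λ^+ : γ_1, …, γ_n ∈ Γ(ω)}) ≤ exp(-2(β-δ)(|γ_1| + ⋯ + |γ_n|)), where μ^+_{Φ,Λ} is canonically regarded as a measure on Ω_Λ^+. -/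

import Mathlib

open scoped BigOperators
open Real MeasureTheory Filter Topology

namespace Ising

/-- The lattice `ℤ^d`. -/
abbrev V (d : ℕ) := Fin d → ℤ
/-- Spin configurations on `ℤ^d`; `true` encodes spin `+1`, `false` encodes spin `-1`. -/
abbrev Config (d : ℕ) := V d → Bool
/-- The ambient euclidean space `ℝ^d`. -/
abbrev Point (d : ℕ) := Fin d → ℝ

variable {d : ℕ}

noncomputable section

/-- The spin value (`±1`) of a boolean. -/
def spin (b : Bool) : ℝ := if b then 1 else -1

/-- An interaction assigns to each finite `Λ ⊆ ℤ^d` a function of configurations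
(only the restriction to `Λ` is relevant; see `IsLocal`). -/
abbrev Interaction (d : ℕ) := Finset (V d) → Config d → ℝ

/-- `Φ_Λ` depends only on the restriction of the configuration to `Λ`. -/
def IsLocal (Φ : Interaction d) : Prop :=
  ∀ (Λ : Finset (V d)) (ω ω' : Config d), (∀ x ∈ Λ, ω x = ω' x) → Φ Λ ω = Φ Λ ω'

/-- Translation of a configuration: `(τ^a ω)(x) = ω(x+a)`. -/
def translate (a : V d) (ω : Config d) : Config d := fun x => ω (x + a)

/-- Translation invariance of an interaction: `Φ_Λ(ω) = Φ_{Λ-a}(τ^a ω)`. -/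
def TransInv (Φ : Interaction d) : Prop :=
  ∀ (a : V d) (Λ : Finset (V d)) (ω : Config d),
    Φ (Λ.image (fun x => x - a)) (translate a ω) = Φ Λ ω

/-- Spin-flip symmetry: `Ψ_Λ(ω) = Ψ_Λ(-ω)`. -/
def SpinFlipSymm (Ψ : Interaction d) : Prop :=
  ∀ (Λ : Finset (V d)) (ω : Config d), Ψ Λ (fun x => !(ω x)) = Ψ Λ ω

/-- `sup_{ω ∈ Ω_Λ} |Φ_Λ(ω)|`. -/
def supNorm (Φ : Interaction d) (Λ : Finset (V d)) : ℝ := ⨆ ω : Config d, |Φ Λ ω|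

/-- The summand of the norm `‖Φ‖`. -/
def normTerm (Φ : Interaction d) (Λ : Finset (V d)) : ℝ :=
  if (0 : V d) ∈ Λ then supNorm Φ Λ else 0

/-- `‖Φ‖ = Σ_{0 ∈ Λ ⋐ ℤ^d} sup_{ω} |Φ_Λ(ω)|`. -/
def anorm (Φ : Interaction d) : ℝ := ∑' Λ : Finset (V d), normTerm Φ Λ

/-- Absolute summability of an interaction. -/
def AbsSummable (Φ : Interaction d) : Prop := Summable (normTerm Φ)

/-- `‖x-y‖_∞`. -/
def distInf (x y : V d) : ℕ := Finset.univ.sup fun i => (x i - y i).natAbs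

/-- `‖x-y‖_1`. -/
def dist1 (x y : V d) : ℕ := ∑ i, (x i - y i).natAbs

/-- `diam(Λ) = sup {‖x-y‖_∞ : x, y ∈ Λ}`. -/
def diam (Λ : Finset (V d)) : ℕ := Λ.sup fun x => Λ.sup fun y => distInf x y

/-- The summand of the `d`-th order decaying norm `|||Ψ|||`. -/
def dTerm (Ψ : Interaction d) (Λ : Finset (V d)) : ℝ :=
  if (0 : V d) ∈ Λ then ((diam Λ + 1 : ℕ) : ℝ) ^ d * supNorm Ψ Λ else 0

/-- `|||Ψ||| = Σ_{0 ∈ Λ ⋐ ℤ^d} (diam(Λ)+1)^d sup_{ω} |Ψ_Λ(ω)|`. -/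
def dnorm (Ψ : Interaction d) : ℝ := ∑' Λ : Finset (V d), dTerm Ψ Λ

/-- Summability of the `d`-th order decaying norm. -/
def DSummable (Ψ : Interaction d) : Prop := Summable (dTerm Ψ)

/-- The summand of the norm `|||Ψ|||'`. -/
def dTerm' (Ψ : Interaction d) (Λ : Finset (V d)) : ℝ :=
  if (0 : V d) ∈ Λ then (Λ.card : ℝ)⁻¹ * ((diam Λ + 1 : ℕ) : ℝ) ^ d * supNorm Ψ Λ else 0

/-- `|||Ψ|||' = Σ_{0 ∈ Λ ⋐ ℤ^d} |Λ|⁻¹ (diam(Λ)+1)^d sup_{ω} |Ψ_Λ(ω)|`. -/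
def dnorm' (Ψ : Interaction d) : ℝ := ∑' Λ : Finset (V d), dTerm' Ψ Λ

/-- Summability of the norm `|||·|||'`. -/
def DSummable' (Ψ : Interaction d) : Prop := Summable (dTerm' Ψ)

/-- The Hamiltonian `H_{Φ,Λ}(ω) = Σ_{Δ ⋐ ℤ^d, Δ ∩ Λ ≠ ∅} Φ_Δ(ω|_Δ)`. -/
def ham (Φ : Interaction d) (Λ : Finset (V d)) (ω : Config d) : ℝ :=
  ∑' Δ : Finset (V d), if (Δ ∩ Λ).Nonempty then Φ Δ ω else 0

/-- The configuration `ω_Λ ∨ η` agreeing with `f` on `Λ` and with `η` off `Λ`. -/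
def fill (Λ : Finset (V d)) (f : ↥Λ → Bool) (η : Config d) : Config d :=
  fun x => if h : x ∈ Λ then f ⟨x, h⟩ else η x

/-- The partition function `Z^η_{Φ,Λ}`. -/
def gibbsZ (Φ : Interaction d) (Λ : Finset (V d)) (η : Config d) : ℝ :=
  ∑ f : ↥Λ → Bool, Real.exp (-(ham Φ Λ (fill Λ f η)))

/-- The finite Gibbs state `μ^η_{Φ,Λ}({ω_Λ})`. -/
def finGibbs (Φ : Interaction d) (Λ : Finset (V d)) (η : Config d) (f : ↥Λ → Bool) : ℝ :=
  Real.exp (-(ham Φ Λ (fill Λ f η))) / gibbsZ Φ Λ η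

/-- The cylinder set `{ξ : ξ|_Λ = f}`. -/
def cyl (Λ : Finset (V d)) (f : ↥Λ → Bool) : Set (Config d) :=
  {ξ | ∀ (x : V d) (h : x ∈ Λ), ξ x = f ⟨x, h⟩}

/-- `σ` is a Gibbs state for `Φ` (DLR condition): for each finite `Λ` there is a Borel
probability measure on boundary conditions with respect to which `σ` of each cylinder
is the average of the finite Gibbs states. -/
def IsGibbs (Φ : Interaction d) (σ : Measure (Config d)) : Prop :=
  IsProbabilityMeasure σ ∧
  ∀ Λ : Finset (V d), ∃ ν : Measure (Config d), IsProbabilityMeasure ν ∧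
    ∀ f : ↥Λ → Bool, (σ (cyl Λ f)).toReal = ∫ η, finGibbs Φ Λ η f ∂ν

/-- Translation invariance of a measure: `τ^a_* σ = σ`. -/
def MeasTransInv (σ : Measure (Config d)) : Prop :=
  ∀ a : V d, σ.map (translate a) = σ

/-- The Ising interaction at inverse temperature `β`:
`Φ^β_Λ(ω) = -β ω(x) ω(y)` if `Λ = {x,y}` with `‖x-y‖₁ = 1`, and `0` otherwise. -/
def ising (β : ℝ) : Interaction d := fun Λ ω =>
  if Λ.card = 2 ∧ ∀ x ∈ Λ, ∀ y ∈ Λ, x ≠ y → dist1 x y = 1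
  then -β * ∏ x ∈ Λ, spin (ω x) else 0

/-- The sum of two interactions. -/
def Iadd (Φ Ψ : Interaction d) : Interaction d := fun Λ ω => Φ Λ ω + Ψ Λ ω

/-- `S` is connected for the adjacency given by `ρ`-distance `1`. -/
def ConnectedBy (ρ : V d → V d → ℕ) (S : Set (V d)) : Prop :=
  ∀ x ∈ S, ∀ y ∈ S, ∃ (n : ℕ) (p : ℕ → V d), p 0 = x ∧ p n = y ∧
    (∀ i ≤ n, p i ∈ S) ∧ ∀ i < n, ρ (p i) (p (i+1)) = 1

/-- `‖·‖₁`-connectedness. -/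
def Conn1 (S : Set (V d)) : Prop := ConnectedBy dist1 S

/-- `‖·‖_∞`-connectedness. -/
def ConnInf (S : Set (V d)) : Prop := ConnectedBy distInf S

/-- A finite set `Λ` is c-connected if both `Λ` and its complement are `‖·‖_∞`-connected. -/
def CConn (Λ : Finset (V d)) : Prop :=
  ConnInf (↑Λ : Set (V d)) ∧ ConnInf ((↑Λ : Set (V d))ᶜ)

/-- `Ψ` vanishes on sets that are not `‖·‖₁`-connected. -/
def ZeroOnNonConn (Ψ : Interaction d) : Prop :=
  ∀ Λ : Finset (V d), ¬ Conn1 (↑Λ : Set (V d)) → ∀ ω, Ψ Λ ω = 0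

/-- The closed unit cube `I_x` centered at `x ∈ ℤ^d`. -/
def cube (x : V d) : Set (Point d) := {y | ∀ i, |y i - (x i : ℝ)| ≤ 1/2}

/-- `M(S) = ⋃_{x ∈ S} I_x`. -/
def cubes (S : Set (V d)) : Set (Point d) := ⋃ x ∈ S, cube x

/-- A contour is the boundary `∂M(S)` of `M(S)` for a finite c-connected `S`. -/
def IsContour (γ : Set (Point d)) : Prop :=
  ∃ S : Finset (V d), CConn S ∧ γ = frontier (cubes ↑S)

/-- The set of sites with spin `-1`. -/
def minusSet (ω : Config d) : Set (V d) := {x | ω x = false}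

/-- `Γ(ω)`: the connected components of `∂M({x : ω(x) = -1})`. -/
def Gamma (ω : Config d) : Set (Set (Point d)) :=
  {γ | ∃ y ∈ frontier (cubes (minusSet ω)),
    γ = connectedComponentIn (frontier (cubes (minusSet ω))) y}

/-- The `(d-1)`-dimensional face of the unit cubes lying between `x` and `x + e_i`. -/
def face (x : V d) (i : Fin d) : Set (Point d) :=
  {y | y i = (x i : ℝ) + 1/2 ∧ ∀ j, j ≠ i → |y j - (x j : ℝ)| ≤ 1/2}

/-- A plaquette is a `(d-1)`-dimensional face of one of the cubes `I_x`. -/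
def IsPlaquette (P : Set (Point d)) : Prop := ∃ x i, P = face x i

/-- `|γ|`: the number of plaquettes contained in `γ`. -/
def csize (γ : Set (Point d)) : ℕ :=
  Nat.card {P : Set (Point d) // IsPlaquette P ∧ P ⊆ γ}

/-- The constant `+1` configuration. -/
def plusC : Config d := fun _ => true

/-- The constant `-1` configuration. -/
def minusC : Config d := fun _ => false

open scoped Classical in
/-- The finite-volume Gibbs probability (with boundary condition `η`) of an event
`A`: `μ^η_{Φ,Λ}({ω : ω ∨ η ∈ A})`. -/
def bcProb (Φ : Interaction d) (Λ : Finset (V d)) (η : Config d) (A : Set (Config d)) : ℝ :=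
  (∑ f : ↥Λ → Bool, if fill Λ f η ∈ A then Real.exp (-(ham Φ Λ (fill Λ f η))) else 0) /
    gibbsZ Φ Λ η

/-- `ω ∈ Ω_Λ^+`, i.e. `ω` is `+1` off `Λ`. -/
def plusOutside (Λ : Finset (V d)) (ω : Config d) : Prop := ∀ x, x ∉ Λ → ω x = true

/-- The configuration obtained by flipping all spins in `S`. -/
def flipOn (S : Finset (V d)) (ω : Config d) : Config d :=
  fun x => if x ∈ S then !(ω x) else ω x

/-- `|𝓔_Λ|`: the number of nearest-neighbour edges meeting `Λ`. -/
def edgeCount (Λ : Finset (V d)) : ℕ :=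
  Nat.card {e : Finset (V d) // (∃ x y, e = {x, y} ∧ dist1 x y = 1) ∧ (e ∩ Λ).Nonempty}

/-- `R` is a (nonempty) rectangle in `ℤ^d`. -/
def IsRect (R : Finset (V d)) : Prop := ∃ a b : V d, a ≤ b ∧ R = Finset.Icc a b

/-- `R(Λ)`: the minimal rectangle containing `Λ`. -/
def minRect (Λ : Finset (V d)) : Finset (V d) :=
  if h : Λ.Nonempty then
    Finset.Icc (fun i => Λ.inf' h fun x => x i) (fun i => Λ.sup' h fun x => x i)
  else ∅

open scoped Classical in
/-- The rectangle regrouping `Ψ̃` of `Ψ`: `Ψ̃_R(ω) = Σ_{Λ : R(Λ) = R} Ψ_Λ(ω|_Λ)` for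
rectangles `R`, and `Ψ̃_Λ = 0` for non-rectangles. -/
def regroup (Ψ : Interaction d) : Interaction d := fun R ω =>
  if IsRect R then ∑ Λ ∈ R.powerset, (if minRect Λ = R then Ψ Λ ω else 0) else 0


/-- The unit vector. -/
def uv (i : Fin d) : V d := Pi.single i 1

/-- Boundary edges of a finite set. -/
def bd (T : Finset (V d)) : Finset (V d × Fin d) :=
  ((T ∪ Finset.univ.biUnion (fun i => T.image (fun x => x - uv i))) ×ˢ Finset.univ).filter
    (fun p => ¬ (p.1 ∈ T ↔ p.1 + uv p.2 ∈ T))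

lemma mem_bd (T : Finset (V d)) (x : V d) (i : Fin d) :
    (x, i) ∈ bd T ↔ ¬ (x ∈ T ↔ x + uv i ∈ T) := by
  simp only [bd, Finset.mem_filter, Finset.mem_product, Finset.mem_univ, and_true,
    and_iff_right_iff_imp, Finset.mem_union, Finset.mem_biUnion, true_and, Finset.mem_image]
  intro h
  by_cases hx : x ∈ T
  · exact Or.inl hx
  · refine Or.inr ⟨i, x + uv i, ?_, by simp⟩
    by_contra h'
    exact h ⟨fun a => absurd a hx, fun a => absurd a h'⟩

lemma uv_same (i : Fin d) : uv i i = 1 := by simp [uv]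
lemma uv_ne {i j : Fin d} (h : j ≠ i) : uv i j = 0 := by simp [uv, h]

lemma int_eq_of_abs {a b : ℤ} {p : ℝ} (h1 : |p - a| ≤ 1/2) (h2 : |p - b| < 1/2) : a = b := by
  rw [abs_le] at h1
  rw [abs_lt] at h2
  have h3 : (a : ℝ) < b + 1 := by linarith
  have h4 : (b : ℝ) < a + 1 := by linarith
  have h3' : a < b + 1 := by exact_mod_cast h3
  have h4' : b < a + 1 := by exact_mod_cast h4
  omega

/-- A point of the face with one adjacent cube in `T`, the other out, is in the frontier. -/
lemma mem_frontier_aux (T : Set (V d)) (a b : V d) (ha : a ∈ T) (hb : b ∉ T) (y : Point d)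
    (hya : y ∈ cube a) (hyb : y ∈ cube b) : y ∈ frontier (cubes T) := by
  rw [frontier_eq_closure_inter_closure]
  constructor
  · apply subset_closure
    simp only [cubes, Set.mem_iUnion]
    exact ⟨a, ha, hya⟩
  · have hc : Tendsto (fun t : ℝ => (fun j => y j + t * ((b j : ℝ) - y j) : Point d))
        (𝓝[>] 0) (𝓝 y) := by
      have : Continuous (fun t : ℝ => (fun j => y j + t * ((b j : ℝ) - y j) : Point d)) := by
        fun_prop
      have h := this.tendsto 0
      simp only [zero_mul, add_zero] at h
      exact h.mono_left nhdsWithin_le_nhds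
    refine mem_closure_of_tendsto hc ?_
    have h1 : ∀ᶠ t : ℝ in 𝓝[>] 0, t ∈ Set.Ioo (0:ℝ) 1 := Ioo_mem_nhdsGT one_pos
    filter_upwards [h1] with t ht
    simp only [cubes, Set.mem_compl_iff, Set.mem_iUnion, not_exists]
    intro z hz hmem
    have : z = b := by
      funext j
      refine int_eq_of_abs (hmem j) ?_
      have h2 := hyb j
      have h3 : y j + t * ((b j : ℝ) - y j) - b j = (1 - t) * (y j - b j) := by ring
      rw [h3, abs_mul, abs_of_pos (by linarith [ht.2])]
      have := ht.1
      have := ht.2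
      nlinarith [abs_nonneg (y j - (b j:ℝ))]
    exact hb (this ▸ hz)

lemma face_subset_cube (x : V d) (i : Fin d) : face x i ⊆ cube x := by
  intro y hy j
  by_cases h : j = i
  · subst h; rw [hy.1]; norm_num
  · exact hy.2 j h

lemma face_subset_cube' (x : V d) (i : Fin d) : face x i ⊆ cube (x + uv i) := by
  intro y hy j
  by_cases h : j = i
  · subst h; rw [hy.1, Pi.add_apply, uv_same]; push_cast; rw [abs_le]; constructor <;> linarith
  · rw [Pi.add_apply, uv_ne h, add_zero]; exact hy.2 j h

/-- Center of the face. -/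
def fcenter (x : V d) (i : Fin d) : Point d := fun j => (x j : ℝ) + if j = i then 1/2 else 0

lemma fcenter_mem (x : V d) (i : Fin d) : fcenter x i ∈ face x i := by
  refine ⟨by simp [fcenter], fun j hj => ?_⟩
  simp [fcenter, hj]

lemma face_subset_frontier (T : Set (V d)) (x : V d) (i : Fin d)
    (h : ¬ (x ∈ T ↔ x + uv i ∈ T)) : face x i ⊆ frontier (cubes T) := by
  intro y hy
  by_cases hx : x ∈ T
  · have hx' : x + uv i ∉ T := fun h' => h ⟨fun _ => h', fun _ => hx⟩
    exact mem_frontier_aux T _ _ hx hx' y (face_subset_cube x i hy) (face_subset_cube' x i hy)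
  · have hx' : x + uv i ∈ T := by
      by_contra h'
      exact h ⟨fun a => absurd a hx, fun a => absurd a h'⟩
    exact mem_frontier_aux T _ _ hx' hx y (face_subset_cube' x i hy) (face_subset_cube x i hy)

lemma of_fcenter_mem (T : Set (V d)) (x : V d) (i : Fin d)
    (h : fcenter x i ∈ frontier (cubes T)) : ¬ (x ∈ T ↔ x + uv i ∈ T) := by
  intro hiff
  have hball : Metric.ball (fcenter x i) (1/2) ∈ 𝓝 (fcenter x i) :=
    Metric.ball_mem_nhds _ (by norm_num)
  have hb : ∀ p ∈ Metric.ball (fcenter x i) (1/2), ∀ j, |p j - fcenter x i j| < 1/2 := by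
    intro p hp j
    have := (dist_pi_lt_iff (by norm_num : (0:ℝ) < 1/2)).1 (Metric.mem_ball.1 hp) j
    rwa [Real.dist_eq] at this
  rw [frontier] at h
  by_cases hx : x ∈ T
  · have hx' := hiff.1 hx
    apply h.2
    rw [mem_interior_iff_mem_nhds]
    refine mem_of_superset hball ?_
    intro p hp
    have hp' := hb p hp
    have hi := hp' i
    simp only [fcenter, if_true] at hi
    rw [abs_lt] at hi
    simp only [cubes, Set.mem_iUnion]
    by_cases hle : p i ≤ x i + 1/2
    · refine ⟨x, hx, fun j => ?_⟩
      by_cases hj : j = i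
      · subst hj; rw [abs_le]; constructor <;> linarith
      · have := hp' j
        simp only [fcenter, hj, if_false, add_zero] at this
        exact this.le
    · refine ⟨x + uv i, hx', fun j => ?_⟩
      by_cases hj : j = i
      · subst hj
        rw [Pi.add_apply, uv_same, abs_le]; push_cast; constructor <;> linarith
      · have := hp' j
        simp only [fcenter, hj, if_false, add_zero] at this
        rw [Pi.add_apply, uv_ne hj, add_zero]
        exact this.le
  · have hx' : x + uv i ∉ T := fun h' => hx (hiff.2 h')
    obtain ⟨p, hp, hpc⟩ := mem_closure_iff_nhds.1 h.1 _ hball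
    simp only [cubes, Set.mem_iUnion] at hpc
    obtain ⟨z, hz, hpz⟩ := hpc
    have hp' := hb p hp
    have hj : ∀ j, j ≠ i → z j = x j := by
      intro j hj
      have := hp' j
      simp only [fcenter, hj, if_false, add_zero] at this
      exact int_eq_of_abs (hpz j) this
    have hi := hp' i
    simp only [fcenter, if_true] at hi
    rw [abs_lt] at hi
    have hzi := hpz i
    rw [abs_le] at hzi
    have h1 : (z i : ℝ) < x i + 2 := by linarith
    have h2 : (x i : ℝ) < z i + 1 := by linarith
    have h1' : z i < x i + 2 := by exact_mod_cast h1
    have h2' : x i < z i + 1 := by exact_mod_cast h2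
    have h3 : z i = x i ∨ z i = x i + 1 := by omega
    rcases h3 with h3 | h3
    · apply hx
      have : z = x := by
        funext j
        by_cases hji : j = i
        · rw [hji, h3]
        · exact hj j hji
      rwa [← this]
    · apply hx'
      have : z = x + uv i := by
        funext j
        by_cases hji : j = i
        · rw [hji, h3, Pi.add_apply, uv_same]
        · rw [Pi.add_apply, uv_ne hji, add_zero, hj j hji]
      rwa [← this]

lemma csize_le (T : Finset (V d)) : csize (frontier (cubes (↑T : Set (V d)))) ≤ (bd T).card := by
  have hcard : Nat.card ↥(bd T) = (bd T).card := by simp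
  rw [csize, ← hcard]
  refine Nat.card_le_card_of_surjective
    (fun p : ↥(bd T) => ⟨face p.1.1 p.1.2, ⟨_, _, rfl⟩,
      face_subset_frontier _ _ _ (by
        have := p.2
        rw [← Prod.mk.eta (p := p.1), mem_bd] at this
        simpa using this)⟩) ?_
  rintro ⟨P, ⟨x, i, rfl⟩, hP⟩
  have := of_fcenter_mem _ x i (hP (fcenter_mem x i))
  refine ⟨⟨(x, i), ?_⟩, rfl⟩
  rw [mem_bd]
  simpa using this

lemma bd_ne (hd : 0 < d) (S T : Finset (V d)) (hS : S.Nonempty) (hST : Disjoint S T) :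
    bd S ≠ bd T := by
  intro h
  let k : Fin d := ⟨0, hd⟩
  obtain ⟨x, hx, hmax⟩ := Finset.exists_max_image (S ∪ T) (fun x => x k)
    (hS.mono Finset.subset_union_left)
  have hnot : x + uv k ∉ S ∪ T := by
    intro h'
    have := hmax _ h'
    simp [uv_same] at this
  have hk : (x, k) ∈ bd S ↔ (x, k) ∈ bd T := by rw [h]
  rw [mem_bd, mem_bd] at hk
  rw [Finset.mem_union] at hnot hx
  have hdx : x ∈ S → x ∉ T := fun h => Finset.disjoint_left.1 hST h
  tauto

lemma dist1_eq_one {x y : V d} (h : dist1 x y = 1) : ∃ i, y = x + uv i ∨ x = y + uv i := by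
  unfold dist1 at h
  have hne : ∃ i, (x i - y i).natAbs ≠ 0 := by
    by_contra hc
    push Not at hc
    rw [Finset.sum_eq_zero (fun i _ => hc i)] at h
    omega
  obtain ⟨i, hi⟩ := hne
  rw [← Finset.add_sum_erase _ _ (Finset.mem_univ i)] at h
  have h0 : ∑ j ∈ Finset.univ.erase i, (x j - y j).natAbs = 0 := by omega
  have hi1 : (x i - y i).natAbs = 1 := by omega
  rw [Finset.sum_eq_zero_iff] at h0
  have hj : ∀ j, j ≠ i → x j = y j := by
    intro j hj
    have := h0 j (Finset.mem_erase.2 ⟨hj, Finset.mem_univ _⟩)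
    omega
  refine ⟨i, ?_⟩
  have : y i = x i + 1 ∨ x i = y i + 1 := by omega
  rcases this with h | h
  · left
    funext j
    by_cases hji : j = i
    · rw [hji, h, Pi.add_apply, uv_same]
    · rw [Pi.add_apply, uv_ne hji, add_zero, hj j hji]
  · right
    funext j
    by_cases hji : j = i
    · rw [hji, h, Pi.add_apply, uv_same]
    · rw [Pi.add_apply, uv_ne hji, add_zero, hj j hji]

lemma dist1_uv (x : V d) (i : Fin d) : dist1 x (x + uv i) = 1 ∧ dist1 (x + uv i) x = 1 := by
  constructor
  · unfold dist1
    rw [Finset.sum_eq_single i]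
    · simp [uv_same]
    · intro j _ hj; simp [uv_ne hj]
    · simp
  · unfold dist1
    rw [Finset.sum_eq_single i]
    · simp [uv_same]
    · intro j _ hj; simp [uv_ne hj]
    · simp

lemma uv_add_ne (x : V d) (i : Fin d) : x ≠ x + uv i := by
  intro h
  have := congrFun h i
  simp [uv_same] at this

/-- Edge as a finset. -/
def edge (p : V d × Fin d) : Finset (V d) := {p.1, p.1 + uv p.2}

lemma uv_inj {i j : Fin d} (h : uv i = uv j) : i = j := by
  by_contra hne
  have := congrFun h i
  rw [uv_same, uv_ne hne] at this
  omega

lemma uv_nonneg (i j : Fin d) : 0 ≤ uv i j := by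
  by_cases h : j = i
  · subst h; simp [uv_same]
  · rw [uv_ne h]

lemma edge_inj : Function.Injective (edge : V d × Fin d → Finset (V d)) := by
  rintro ⟨x, i⟩ ⟨y, j⟩ h
  have hx : x ∈ edge (y, j) := by rw [← h]; simp [edge]
  have hx2 : x + uv i ∈ edge (y, j) := by rw [← h]; simp [edge]
  have hy : y ∈ edge (x, i) := by rw [h]; simp [edge]
  simp only [edge, Finset.mem_insert, Finset.mem_singleton] at hx hx2 hy
  rcases hx with rfl | hx
  · rcases hx2 with h2 | h2
    · exact absurd h2.symm (uv_add_ne _ _)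
    · rw [uv_inj (add_left_cancel h2)]
  · rcases hy with rfl | hy
    · exact absurd hx (uv_add_ne _ _)
    · exfalso
      have h3 := congrFun hx i
      have h4 := congrFun hy i
      simp only [Pi.add_apply, uv_same] at h3 h4
      have := uv_nonneg j i
      omega

/-- A connected set crossing `U` contains a boundary edge. -/
lemma exists_bd_edge (U Δ : Finset (V d)) (hc : Conn1 (↑Δ : Set (V d)))
    (x y : V d) (hx : x ∈ Δ) (hxU : x ∈ U) (hy : y ∈ Δ) (hyU : y ∉ U) :
    ∃ p ∈ bd U, edge p ⊆ Δ := by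
  obtain ⟨n, p, h0, hn, hmem, hstep⟩ := hc x hx y hy
  have hex : ∃ k, k < n ∧ p k ∈ U ∧ p (k+1) ∉ U := by
    by_contra hcon
    push Not at hcon
    have : ∀ k, k ≤ n → p k ∈ U := by
      intro k
      induction k with
      | zero => intro _; rwa [h0]
      | succ k ih => intro hk; exact hcon k (by omega) (ih (by omega))
    exact hyU (hn ▸ this n le_rfl)
  obtain ⟨k, hk, hkU, hkU'⟩ := hex
  have m1 : p k ∈ Δ := hmem k hk.le
  have m2 : p (k+1) ∈ Δ := hmem (k+1) hk
  obtain ⟨i, hi | hi⟩ := dist1_eq_one (hstep k hk)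
  · refine ⟨(p k, i), ?_, ?_⟩
    · rw [mem_bd, ← hi]; tauto
    · intro z hz
      simp only [edge, Finset.mem_insert, Finset.mem_singleton, ← hi] at hz
      rcases hz with rfl | rfl <;> assumption
  · refine ⟨(p (k+1), i), ?_, ?_⟩
    · rw [mem_bd, ← hi]; tauto
    · intro z hz
      simp only [edge, Finset.mem_insert, Finset.mem_singleton, ← hi] at hz
      rcases hz with rfl | rfl <;> assumption

lemma supNorm_bdd (Ψ : Interaction d) (hloc : IsLocal Ψ) (Δ : Finset (V d)) :
    BddAbove (Set.range (fun ω : Config d => |Ψ Δ ω|)) := by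
  apply Set.Finite.bddAbove
  refine (Set.finite_range (fun f : ↥Δ → Bool => |Ψ Δ (fill Δ f plusC)|)).subset ?_
  rintro _ ⟨ω, rfl⟩
  refine ⟨fun x => ω x, ?_⟩
  simp only
  rw [hloc Δ (fill Δ (fun x => ω x) plusC) ω]
  intro x hx
  simp [fill, hx]

lemma le_supNorm (Ψ : Interaction d) (hloc : IsLocal Ψ) (Δ : Finset (V d)) (ω : Config d) :
    |Ψ Δ ω| ≤ supNorm Ψ Δ := le_ciSup (supNorm_bdd Ψ hloc Δ) ω

lemma supNorm_nonneg (Ψ : Interaction d) (Δ : Finset (V d)) : 0 ≤ supNorm Ψ Δ :=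
  Real.iSup_nonneg (fun _ => abs_nonneg _)

lemma supNorm_image (Ψ : Interaction d) (hti : TransInv Ψ) (a : V d) (Δ : Finset (V d)) :
    supNorm Ψ (Δ.image (fun x => x - a)) = supNorm Ψ Δ := by
  unfold supNorm
  let e : Config d ≃ Config d :=
    ⟨translate a, translate (-a), fun ω => by funext x; simp [translate],
      fun ω => by funext x; simp [translate]⟩
  rw [← e.iSup_comp (g := fun ω => |Ψ (Δ.image (fun x => x - a)) ω|)]
  congr 1
  funext ω
  exact congrArg _ (hti a Δ ω)

/-- The translation of finite sets. -/
def shiftE (a : V d) : Finset (V d) ≃ Finset (V d) :=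
  ⟨fun Δ => Δ.image (fun x => x - a), fun Δ => Δ.image (fun x => x + a),
    fun Δ => by beta_reduce; rw [Finset.image_image]; simp [Function.comp_def],
    fun Δ => by beta_reduce; rw [Finset.image_image]; simp [Function.comp_def]⟩

/-- Norm term based at `a`. -/
def nt (Ψ : Interaction d) (a : V d) (Δ : Finset (V d)) : ℝ := if a ∈ Δ then supNorm Ψ Δ else 0

lemma nt_eq (Ψ : Interaction d) (hti : TransInv Ψ) (a : V d) :
    nt Ψ a = normTerm Ψ ∘ shiftE a := by
  funext Δ
  simp only [nt, normTerm, Function.comp, shiftE, Equiv.coe_fn_mk, supNorm_image Ψ hti]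
  congr 1
  simp [sub_eq_zero]

lemma nt_summable (Ψ : Interaction d) (hti : TransInv Ψ) (hsum : AbsSummable Ψ) (a : V d) :
    Summable (nt Ψ a) := by
  rw [nt_eq Ψ hti]
  exact (shiftE a).summable_iff.2 hsum

lemma nt_tsum (Ψ : Interaction d) (hti : TransInv Ψ) (a : V d) :
    ∑' Δ, nt Ψ a Δ = anorm Ψ := by
  rw [nt_eq Ψ hti]
  exact (shiftE a).tsum_eq (normTerm Ψ)

lemma nt_nonneg (Ψ : Interaction d) (a : V d) (Δ : Finset (V d)) : 0 ≤ nt Ψ a Δ := by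
  unfold nt; split_ifs
  · exact supNorm_nonneg _ _
  · exact le_rfl

/-- The summand of the Hamiltonian. -/
def hterm (Φ : Interaction d) (Λ : Finset (V d)) (ω : Config d) (Δ : Finset (V d)) : ℝ :=
  if (Δ ∩ Λ).Nonempty then Φ Δ ω else 0

lemma psi_summable (Ψ : Interaction d) (hloc : IsLocal Ψ) (hti : TransInv Ψ)
    (hsum : AbsSummable Ψ) (Λ : Finset (V d)) (ω : Config d) : Summable (hterm Ψ Λ ω) := by
  refine Summable.of_norm_bounded (g := fun Δ => ∑ a ∈ Λ, nt Ψ a Δ)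
    (summable_sum (fun a _ => nt_summable Ψ hti hsum a)) ?_
  intro Δ
  unfold hterm
  split_ifs with h
  · obtain ⟨a, ha⟩ := h
    rw [Finset.mem_inter] at ha
    have h1 : nt Ψ a Δ = supNorm Ψ Δ := by simp [nt, ha.1]
    calc ‖Ψ Δ ω‖ ≤ supNorm Ψ Δ := le_supNorm Ψ hloc Δ ω
      _ = nt Ψ a Δ := h1.symm
      _ ≤ _ := Finset.single_le_sum (f := fun a => nt Ψ a Δ) (fun a _ => nt_nonneg Ψ a Δ) ha.2
  · simpa using Finset.sum_nonneg (fun a _ => nt_nonneg Ψ a Δ)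

lemma spin_not (b : Bool) : spin (!b) = - spin b := by cases b <;> simp [spin]

lemma ising_edge (β : ℝ) (p : V d × Fin d) (ω : Config d) :
    ising β (edge p) ω = -β * (spin (ω p.1) * spin (ω (p.1 + uv p.2))) := by
  have hne := uv_add_ne p.1 p.2
  unfold ising
  rw [if_pos]
  · rw [edge, Finset.prod_pair hne]
  · refine ⟨by rw [edge, Finset.card_pair hne], ?_⟩
    intro x hx y hy hxy
    have := dist1_uv p.1 p.2
    simp only [edge, Finset.mem_insert, Finset.mem_singleton] at hx hy
    rcases hx with rfl | rfl <;> rcases hy with rfl | rfl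
    · exact absurd rfl hxy
    · exact this.1
    · exact this.2
    · exact absurd rfl hxy

lemma ising_ne (β : ℝ) (Δ : Finset (V d)) (ω : Config d) (h : ising β Δ ω ≠ 0) :
    ∃ p, Δ = edge p := by
  unfold ising at h
  split_ifs at h with hc
  · obtain ⟨x, y, hxy, rfl⟩ := Finset.card_eq_two.1 hc.1
    obtain ⟨i, rfl | rfl⟩ := dist1_eq_one (hc.2 x (by simp) y (by simp) hxy)
    · exact ⟨(x, i), rfl⟩
    · exact ⟨(y, i), by rw [edge, Finset.pair_comm]⟩
  · exact absurd rfl h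

lemma ising_summable (β : ℝ) (Λ : Finset (V d)) (ω : Config d) :
    Summable (hterm (ising β) Λ ω) := by
  refine summable_of_ne_finset_zero (s := ((Λ ∪ Finset.univ.biUnion
    (fun i => Λ.image (fun x => x - uv i))) ×ˢ Finset.univ).image edge) ?_
  intro Δ hΔ
  by_contra hne
  apply hΔ
  unfold hterm at hne
  split_ifs at hne with h
  · obtain ⟨p, rfl⟩ := ising_ne _ _ _ hne
    refine Finset.mem_image.2 ⟨p, ?_, rfl⟩
    obtain ⟨z, hz⟩ := h
    rw [Finset.mem_inter] at hz
    simp only [edge, Finset.mem_insert, Finset.mem_singleton] at hz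
    simp only [Finset.mem_product, Finset.mem_univ, and_true, Finset.mem_union,
      Finset.mem_biUnion, true_and, Finset.mem_image]
    rcases hz with ⟨rfl | rfl, hz⟩
    · exact Or.inl hz
    · exact Or.inr ⟨p.2, _, hz, by simp⟩
  · exact absurd rfl hne

lemma ising_diff (β : ℝ) (Λ U : Finset (V d)) (hU : U ⊆ Λ) (ω : Config d)
    (hω : ∀ p ∈ bd U, ω p.1 ≠ ω (p.1 + uv p.2)) :
    ∑' Δ, (hterm (ising β) Λ ω Δ - hterm (ising β) Λ (flipOn U ω) Δ) = 2 * β * (bd U).card := by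
  rw [tsum_eq_sum (s := (bd U).image edge)]
  · rw [Finset.sum_image (fun a _ b _ h => edge_inj h)]
    rw [Finset.sum_congr rfl (g := fun _ => 2 * β), Finset.sum_const, nsmul_eq_mul, mul_comm]
    rintro ⟨x, i⟩ hp
    have hw := hω _ hp
    rw [mem_bd] at hp
    have hne : (edge (x, i) ∩ Λ).Nonempty := by
      by_cases hx : x ∈ U
      · exact ⟨x, by simp [edge, hU hx]⟩
      · have : x + uv i ∈ U := by tauto
        exact ⟨x + uv i, by simp [edge, hU this]⟩
    simp only [hterm, if_pos hne, ising_edge]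
    have h1 : spin (ω x) * spin (ω (x + uv i)) = -1 := by
      have : ω (x + uv i) = !(ω x) := by
        revert hw; simp only; cases ω x <;> cases ω (x + uv i) <;> simp
      rw [this]; cases ω x <;> simp [spin]
    have h2 : spin (flipOn U ω x) * spin (flipOn U ω (x + uv i)) = 1 := by
      by_cases hx : x ∈ U
      · have hx' : x + uv i ∉ U := by tauto
        simp only [flipOn, if_pos hx, if_neg hx', spin_not]; linarith
      · have hx' : x + uv i ∈ U := by tauto
        simp only [flipOn, if_pos hx', if_neg hx, spin_not]; linarith
    rw [h1, h2]; ring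
  · intro Δ hΔ
    unfold hterm
    split_ifs with h
    · by_cases hed : ∃ p, Δ = edge p
      · obtain ⟨⟨x, i⟩, rfl⟩ := hed
        have hp : (x, i) ∉ bd U := fun h' => hΔ (Finset.mem_image_of_mem _ h')
        rw [mem_bd, not_not] at hp
        rw [ising_edge, ising_edge]
        by_cases hx : x ∈ U
        · simp only [flipOn, if_pos hx, if_pos (hp.1 hx), spin_not]; ring
        · have hx' : x + uv i ∉ U := fun h => hx (hp.2 h)
          simp only [flipOn, if_neg hx, if_neg hx']; ring
      · have h0 : ∀ ω' : Config d, ising β Δ ω' = 0 := by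
          intro ω'
          by_contra h'
          exact hed (ising_ne _ _ _ h')
        rw [h0, h0, sub_zero]
    · simp

lemma psi_diff (Ψ : Interaction d) (hloc : IsLocal Ψ) (hti : TransInv Ψ) (hsf : SpinFlipSymm Ψ)
    (hzero : ZeroOnNonConn Ψ) (hsum : AbsSummable Ψ)
    (Λ U : Finset (V d)) (ω : Config d) :
    -(2 * (bd U).card * anorm Ψ) ≤
      ∑' Δ, (hterm Ψ Λ ω Δ - hterm Ψ Λ (flipOn U ω) Δ) := by
  have hs : Summable (fun Δ => hterm Ψ Λ ω Δ - hterm Ψ Λ (flipOn U ω) Δ) :=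
    (psi_summable Ψ hloc hti hsum Λ ω).sub (psi_summable Ψ hloc hti hsum Λ _)
  have hs1 : Summable (fun Δ => ∑ p ∈ bd U, nt Ψ p.1 Δ) :=
    summable_sum (fun p _ => nt_summable Ψ hti hsum p.1)
  have ht : ∑' Δ, -(2 * ∑ p ∈ bd U, nt Ψ p.1 Δ) = -(2 * (bd U).card * anorm Ψ) := by
    have h1 : HasSum (fun Δ => ∑ p ∈ bd U, nt Ψ p.1 Δ) (∑ p ∈ bd U, anorm Ψ) := by
      refine hasSum_sum (fun p _ => ?_)
      rw [← nt_tsum Ψ hti p.1]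
      exact (nt_summable Ψ hti hsum p.1).hasSum
    refine ((h1.mul_left 2).neg).tsum_eq.trans ?_
    rw [Finset.sum_const, nsmul_eq_mul]; ring
  rw [← ht]
  refine Summable.tsum_le_tsum ?_ (hs1.mul_left 2).neg hs
  intro Δ
  have hnn : 0 ≤ ∑ p ∈ bd U, nt Ψ p.1 Δ := Finset.sum_nonneg (fun p _ => nt_nonneg Ψ p.1 Δ)
  by_cases heq : Ψ Δ ω = Ψ Δ (flipOn U ω)
  · have : hterm Ψ Λ ω Δ - hterm Ψ Λ (flipOn U ω) Δ = 0 := by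
      unfold hterm; rw [heq, sub_self]
    rw [this]; linarith
  · have hc : Conn1 (↑Δ : Set (V d)) := by
      by_contra hc
      exact heq (by rw [hzero Δ hc, hzero Δ hc])
    have hx : ∃ x ∈ Δ, x ∈ U := by
      by_contra hcon
      push Not at hcon
      apply heq
      apply hloc
      intro x hx
      simp [flipOn, hcon x hx]
    have hy : ∃ y ∈ Δ, y ∉ U := by
      by_contra hcon
      push Not at hcon
      apply heq
      rw [← hsf Δ ω]
      apply hloc
      intro x hx
      simp [flipOn, hcon x hx]
    obtain ⟨x, hx, hxU⟩ := hx
    obtain ⟨y, hy, hyU⟩ := hy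
    obtain ⟨p, hp, hpΔ⟩ := exists_bd_edge U Δ hc x y hx hxU hy hyU
    have hpm : p.1 ∈ Δ := hpΔ (by simp [edge])
    have h1 : supNorm Ψ Δ ≤ ∑ p ∈ bd U, nt Ψ p.1 Δ := by
      have h1 : nt Ψ p.1 Δ = supNorm Ψ Δ := by simp [nt, hpm]
      rw [← h1]
      exact Finset.single_le_sum (f := fun p : V d × Fin d => nt Ψ p.1 Δ)
        (fun p _ => nt_nonneg Ψ p.1 Δ) hp
    have h2 := abs_le.1 (le_supNorm Ψ hloc Δ ω)
    have h3 := abs_le.1 (le_supNorm Ψ hloc Δ (flipOn U ω))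
    unfold hterm
    split_ifs with h
    · linarith
    · linarith

lemma ham_diff (β δ : ℝ) (Ψ : Interaction d) (hloc : IsLocal Ψ) (hti : TransInv Ψ)
    (hsf : SpinFlipSymm Ψ) (hzero : ZeroOnNonConn Ψ) (hsum : AbsSummable Ψ) (hn : anorm Ψ < δ)
    (Λ U : Finset (V d)) (hU : U ⊆ Λ) (ω : Config d)
    (hω : ∀ p ∈ bd U, ω p.1 ≠ ω (p.1 + uv p.2)) :
    ham (Iadd (ising β) Ψ) Λ (flipOn U ω) + 2 * (β - δ) * (bd U).card ≤
      ham (Iadd (ising β) Ψ) Λ ω := by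
  have hh : ∀ ω', ham (Iadd (ising β) Ψ) Λ ω' =
      ∑' Δ, hterm (ising β) Λ ω' Δ + ∑' Δ, hterm Ψ Λ ω' Δ := by
    intro ω'
    rw [← (ising_summable β Λ ω').tsum_add (psi_summable Ψ hloc hti hsum Λ ω')]
    unfold ham
    congr 1
    funext Δ
    unfold hterm Iadd
    split_ifs <;> simp
  have h1 := ising_diff β Λ U hU ω hω
  have h2 := psi_diff Ψ hloc hti hsf hzero hsum Λ U ω
  rw [(ising_summable β Λ ω).tsum_sub (ising_summable β Λ _)] at h1
  rw [(psi_summable Ψ hloc hti hsum Λ ω).tsum_sub (psi_summable Ψ hloc hti hsum Λ _)] at h2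
  rw [hh, hh]
  have h3 : (0:ℝ) ≤ (bd U).card := Nat.cast_nonneg _
  nlinarith

/-- Geometry of the event. -/
lemma geom (hd : 0 < d) {n : ℕ} (S : Fin n → Finset (V d))
    (hdisj : ∀ i j, i ≠ j → Disjoint (S i) (S j)) (ω : Config d)
    (hω : ∀ i, frontier (cubes (↑(S i) : Set (V d))) ∈ Gamma ω) :
    (∀ p ∈ bd (Finset.univ.biUnion S), ω p.1 ≠ ω (p.1 + uv p.2)) ∧
    ∑ i, (csize (frontier (cubes (↑(S i) : Set (V d)))) : ℝ) ≤
      (bd (Finset.univ.biUnion S)).card := by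
  have hmem : ∀ i x k, (x, k) ∈ bd (S i) ↔ fcenter x k ∈ frontier (cubes (↑(S i) : Set (V d))) := by
    intro i x k
    rw [mem_bd]
    constructor
    · intro h
      exact face_subset_frontier _ x k (by simpa using h) (fcenter_mem x k)
    · intro h
      simpa using of_fcenter_mem _ x k h
  have hdis : ∀ i j, i ≠ j → Disjoint (bd (S i)) (bd (S j)) := by
    intro i j hij
    rw [Finset.disjoint_left]
    rintro ⟨x, k⟩ hi hj
    have hne : (S i).Nonempty := by
      rw [mem_bd] at hi
      by_contra hne
      rw [Finset.not_nonempty_iff_eq_empty] at hne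
      rw [hne] at hi
      simp at hi
    apply bd_ne hd (S i) (S j) hne (hdisj i j hij)
    have hfr : frontier (cubes (↑(S i) : Set (V d))) = frontier (cubes (↑(S j) : Set (V d))) := by
      rw [hmem] at hi hj
      obtain ⟨y, hy, hy'⟩ := hω i
      obtain ⟨z, hz, hz'⟩ := hω j
      rw [hy'] at hi
      rw [hz'] at hj
      rw [hy', hz', connectedComponentIn_eq hi, connectedComponentIn_eq hj]
    ext ⟨x', k'⟩
    rw [hmem, hmem, hfr]
  have hsub : ∀ i, bd (S i) ⊆ bd (Finset.univ.biUnion S) := by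
    rintro i ⟨x, k⟩ hp
    rw [mem_bd]
    simp only [Finset.mem_biUnion, Finset.mem_univ, true_and]
    have key : ∀ a b : V d, a ∈ S i → b ∉ S i →
        (∀ j, (a ∈ S j ↔ b ∈ S j) ∨ j = i) → ¬ ∃ j, b ∈ S j := by
      rintro a b ha hb hj ⟨j, hbj⟩
      have hji : j ≠ i := by rintro rfl; exact hb hbj
      have haj : a ∈ S j := ((hj j).resolve_right hji).2 hbj
      exact Finset.disjoint_left.1 (hdisj j i hji) haj ha
    have hoth : ∀ j, (x ∈ S j ↔ x + uv k ∈ S j) ∨ j = i := by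
      intro j
      by_cases hji : j = i
      · exact Or.inr hji
      · left
        have := Finset.disjoint_left.1 (hdis i j (Ne.symm hji)) hp
        rw [mem_bd, not_not] at this
        exact this
    rw [mem_bd] at hp
    by_cases hx : x ∈ S i
    · have hx' : x + uv k ∉ S i := by tauto
      intro h
      exact key _ _ hx hx' hoth (h.1 ⟨i, hx⟩)
    · have hx' : x + uv k ∈ S i := by tauto
      intro h
      exact key _ _ hx' hx (fun j => (hoth j).imp Iff.symm id) (h.2 ⟨i, hx'⟩)
  constructor
  · rintro ⟨x, k⟩ hp
    have hi : ∃ i, (x, k) ∈ bd (S i) := by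
      by_contra hcon
      push Not at hcon
      rw [mem_bd] at hp
      apply hp
      simp only [Finset.mem_biUnion, Finset.mem_univ, true_and]
      refine exists_congr fun i => ?_
      have := hcon i
      rwa [mem_bd, not_not] at this
    obtain ⟨i, hi⟩ := hi
    rw [hmem] at hi
    obtain ⟨y, hy, hy'⟩ := hω i
    rw [hy'] at hi
    have := of_fcenter_mem _ _ _ (connectedComponentIn_subset _ _ hi)
    intro heq
    apply this
    simp only at heq
    simp only [minusSet, Set.mem_ofPred_eq, heq]
  · have h1 : (∑ i, (bd (S i)).card) ≤ (bd (Finset.univ.biUnion S)).card := by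
      rw [← Finset.card_biUnion (fun i _ j _ hij => hdis i j hij)]
      exact Finset.card_le_card (Finset.biUnion_subset.2 (fun i _ => hsub i))
    have h2 : ∑ i, csize (frontier (cubes (↑(S i) : Set (V d)))) ≤
        (bd (Finset.univ.biUnion S)).card :=
      (Finset.sum_le_sum (fun i _ => csize_le (S i))).trans h1
    exact_mod_cast h2

/-- Flip on the level of restricted configurations. -/
def flipF (Λ U : Finset (V d)) (f : ↥Λ → Bool) : ↥Λ → Bool :=
  fun x => if (x : V d) ∈ U then !(f x) else f x

lemma flipF_inv (Λ U : Finset (V d)) : Function.Involutive (flipF Λ U) := by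
  intro f
  funext x
  by_cases h : (x : V d) ∈ U <;> simp [flipF, h]

lemma fill_flipF (Λ U : Finset (V d)) (hU : U ⊆ Λ) (f : ↥Λ → Bool) (η : Config d) :
    fill Λ (flipF Λ U f) η = flipOn U (fill Λ f η) := by
  funext x
  by_cases h : x ∈ Λ
  · simp [fill, flipF, flipOn, h]
  · have : x ∉ U := fun h' => h (hU h')
    simp [fill, flipOn, h, this]

/-- Peierls estimate for perturbed Ising models: if `Λ` is c-connected and
`γ_1, …, γ_n` are contours (with interiors `S i`) whose interiors are contained in `Λ`
and pairwise disjoint, then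
`μ⁺_{Φ,Λ}({ω ∈ Ω_Λ^+ : γ_1, …, γ_n ∈ Γ(ω)}) ≤ exp(-2(β-δ)(|γ_1| + ⋯ + |γ_n|))`. -/
theorem contour_probability_bound (d : ℕ) (hd : 2 ≤ d) (β δ : ℝ) (hβ : 0 < β)
    (hδ0 : 0 < δ) (hδ1 : δ < 1)
    (Ψ : Interaction d) (hloc : IsLocal Ψ) (hti : TransInv Ψ) (hsf : SpinFlipSymm Ψ)
    (hzero : ZeroOnNonConn Ψ) (hsum : AbsSummable Ψ) (hn : anorm Ψ < δ)
    (Λ : Finset (V d)) (hΛ : CConn Λ) (n : ℕ) (S : Fin n → Finset (V d))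
    (hS : ∀ i, CConn (S i)) (hSΛ : ∀ i, S i ⊆ Λ)
    (hdisj : ∀ i j, i ≠ j → Disjoint (S i) (S j)) :
    bcProb (Iadd (ising β) Ψ) Λ plusC
        {ω | ∀ i, frontier (cubes (↑(S i) : Set (V d))) ∈ Gamma ω}
      ≤ Real.exp (-2*(β-δ) *
          ∑ i, (csize (frontier (cubes (↑(S i) : Set (V d)))) : ℝ)) := by
  classical
  set U := Finset.univ.biUnion S with hUdef
  set C := ∑ i, (csize (frontier (cubes (↑(S i) : Set (V d)))) : ℝ) with hC
  have hC0 : 0 ≤ C := Finset.sum_nonneg (fun i _ => Nat.cast_nonneg _)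
  have hU : U ⊆ Λ := Finset.biUnion_subset.2 (fun i _ => hSΛ i)
  set Φ := Iadd (ising β) Ψ
  have hZ : 0 < gibbsZ Φ Λ plusC :=
    Finset.sum_pos (fun f _ => Real.exp_pos _) Finset.univ_nonempty
  unfold bcProb
  rw [div_le_iff₀ hZ]
  rcases le_total δ β with hle | hle
  · have hre : gibbsZ Φ Λ plusC =
        ∑ f : ↥Λ → Bool, Real.exp (-(ham Φ Λ (flipOn U (fill Λ f plusC)))) := by
      unfold gibbsZ
      rw [← Equiv.sum_comp (flipF_inv Λ U).toPerm]
      refine Finset.sum_congr rfl fun f _ => ?_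
      rw [Function.Involutive.coe_toPerm, fill_flipF Λ U hU]
    rw [hre, Finset.mul_sum]
    refine Finset.sum_le_sum fun f _ => ?_
    split_ifs with hf
    · obtain ⟨h1, h2⟩ := geom (by omega) S hdisj _ hf
      have h3 := ham_diff β δ Ψ hloc hti hsf hzero hsum hn Λ U hU _ h1
      rw [← Real.exp_add, Real.exp_le_exp]
      have h4 : (β - δ) * C ≤ (β - δ) * (bd U).card :=
        mul_le_mul_of_nonneg_left h2 (by linarith)
      linarith
    · positivity
  · have h1 : 1 ≤ Real.exp (-2*(β-δ) * C) := by
      apply Real.one_le_exp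
      have := mul_nonneg (sub_nonneg.2 hle) hC0
      linarith
    refine le_trans ?_ (le_mul_of_one_le_left hZ.le h1)
    unfold gibbsZ
    refine Finset.sum_le_sum fun f _ => ?_
    split_ifs
    · exact le_rfl
    · positivity


end
end Ising
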